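/- arXiv:2312.11227 — 2 statements merged into one kernel-verified Lean document; each statement's English description precedes it below -/
import Mathlib

section
/- Let γ ∈ [0,1], let ι be a finite index set, let w : ι → ℝ satisfy w(i) ≥ 0 for all i and ∑_{i∈ι} w(i) = 1, let N : ι → ℕ, and let M ∈ ℕ satisfy ∑_{i∈ι} w(i)·N(i) ≤ M. Then ∑_{i∈ι} w(i)·(∑_{n=0}^{N(i)} γ^n) ≤ ∑_{n=0}^{M} γ^n. -/
/-- Partial sums of an antitone sequence lie below their tangent lines. -/
theorem Antitone.sum_range_succ_le_add_mul_sub {a : ℕ → ℝ} (ha : Antitone a) (k M : ℕ) :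
    ∑ n ∈ Finset.range (k + 1), a n ≤
      ∑ n ∈ Finset.range (M + 1), a n + a M * ((k : ℝ) - M) := by
  rcases le_total M k with h | h
  · induction k, h using Nat.le_induction with
    | base => simp
    | succ k h ih =>
      rw [Finset.sum_range_succ]
      have := ha (show M ≤ k + 1 by lia)
      push_cast
      linarith
  · induction M, h using Nat.le_induction with
    | base => simp
    | succ M h ih =>
      rw [Finset.sum_range_succ _ (M + 1)]
      have hk : (0 : ℝ) ≤ (M : ℝ) - k := sub_nonneg.2 (Nat.cast_le.2 h)
      have := mul_le_mul_of_nonneg_right (ha (Nat.le_succ M)) hk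
      push_cast
      linarith

/-- Maximization step: a probability-weighted sum of truncated geometric series
with expected budget at most `M` is bounded by the series truncated at `M`. -/
theorem weighted_truncated_geometric_le
    (γ : ℝ) (hγ0 : 0 ≤ γ) (hγ1 : γ ≤ 1)
    {ι : Type*} [Fintype ι] (w : ι → ℝ) (hw : ∀ i, 0 ≤ w i)
    (hw1 : (∑ i, w i) = 1) (N : ι → ℕ) (M : ℕ)
    (hN : (∑ i, w i * (N i : ℝ)) ≤ (M : ℝ)) :
    (∑ i, w i * ∑ n ∈ Finset.range (N i + 1), γ ^ n) ≤
      ∑ n ∈ Finset.range (M + 1), γ ^ n := by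
  calc ∑ i, w i * ∑ n ∈ Finset.range (N i + 1), γ ^ n
      ≤ ∑ i, w i * (∑ n ∈ Finset.range (M + 1), γ ^ n + γ ^ M * ((N i : ℝ) - M)) :=
        Finset.sum_le_sum fun i _ => mul_le_mul_of_nonneg_left
          ((pow_right_anti₀ hγ0 hγ1).sum_range_succ_le_add_mul_sub (N i) M) (hw i)
    _ = (∑ i, w i) * (∑ n ∈ Finset.range (M + 1), γ ^ n) +
          γ ^ M * (∑ i, w i * (N i : ℝ) - (∑ i, w i) * M) := by
        rw [Finset.sum_mul, Finset.sum_mul, ← Finset.sum_sub_distrib, Finset.mul_sum,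
          ← Finset.sum_add_distrib]
        exact Finset.sum_congr rfl fun i _ => by ring
    _ ≤ ∑ n ∈ Finset.range (M + 1), γ ^ n := by
        rw [hw1, one_mul, one_mul]
        linarith [mul_nonneg (pow_nonneg hγ0 M) (sub_nonneg.2 hN)]
end

section
/- Let b₀ ∈ [0,1) and b₁ = 1 − b₀ > 0. The function p ↦ max(b₀ + b₁·p, b₁·(1 − p)) on [0,1] attains its minimum at p* = max(0, (b₁ − b₀)/(2·b₁)), with minimum value max(b₀ + b₁·p*, 1/2). In particular, the minimizing probability p* is not constant in b₀: p*(0) = 1/2 ≠ 1/4 = p*(1/3), so the worst-case transition probability depends on the belief (b₀, b₁). -/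
/-- The worst-case transition probability is belief-dependent: for a belief
`(b₀, b₁)` with `b₁ = 1 - b₀`, the adversary's minimizer of
`p ↦ max (b₀ + b₁·p) (b₁·(1-p))` over `[0,1]` is
`p* = max 0 ((b₁ - b₀)/(2·b₁))`, with minimum value `max (b₀ + b₁·p*) (1/2)`;
and `p*` differs between the beliefs `b₀ = 0` and `b₀ = 1/3`. -/
theorem worst_case_transition_belief_dependent
    (b₀ : ℝ) (hb₀ : b₀ ∈ Set.Ico (0:ℝ) 1) (b₁ : ℝ) (hb₁ : b₁ = 1 - b₀) :
    let pstar : ℝ → ℝ := fun b => max 0 ((1 - b - b) / (2 * (1 - b)))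
    pstar b₀ ∈ Set.Icc (0:ℝ) 1 ∧
    (∀ p ∈ Set.Icc (0:ℝ) 1,
      max (b₀ + b₁ * pstar b₀) (b₁ * (1 - pstar b₀)) ≤
        max (b₀ + b₁ * p) (b₁ * (1 - p))) ∧
    max (b₀ + b₁ * pstar b₀) (b₁ * (1 - pstar b₀)) =
      max (b₀ + b₁ * pstar b₀) (1/2) ∧
    pstar 0 = 1/2 ∧ pstar (1/3) = 1/4 ∧ pstar 0 ≠ pstar (1/3) := by
  intro pstar
  obtain ⟨h0, h1⟩ := hb₀
  subst hb₁
  have hpos : 0 < 1 - b₀ := by linarith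
  have h_zero : pstar 0 = 1 / 2 := by norm_num [pstar]
  have h_third : pstar (1 / 3) = 1 / 4 := by norm_num [pstar]
  have hmul : (1 - b₀) * pstar b₀ = max 0 ((1 - b₀ - b₀) / 2) := by
    simp only [pstar]
    rw [mul_max_of_nonneg _ _ hpos.le, mul_zero]
    congr 1
    field_simp
  refine ⟨⟨le_max_left _ _, max_le zero_le_one ?_⟩, fun p hp => ?_, ?_, h_zero, h_third, ?_⟩
  · rw [div_le_one (by positivity)]
    linarith
  · have hp0 : 0 ≤ (1 - b₀) * p := mul_nonneg hpos.le hp.1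
    rw [mul_one_sub, mul_one_sub, hmul]
    grind
  · rw [mul_one_sub, hmul]
    grind
  · rw [h_zero, h_third]
    norm_num
end
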